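/- Let n_1 ≤ ⋯ ≤ n_r be positive integers and let X(ℂP^n, n_1,…,n_r) be the quotient of ℂP^n × S^{n_1} × ⋯ × S^{n_r} by the identification (y, x_1,…,x_r) ∼ (τ(y), −x_1,…,−x_r), where τ is complex conjugation on ℂP^n. Then TC(X(ℂP^n, n_1,…,n_r)) ≤ 2(n_1 + r + n) − 1. -/

import Mathlib

open Set

namespace Paper

/-- `X` admits a motion planning cover of size `k`. -/
def HasMPCover (X : Type*) [TopologicalSpace X] (k : ℕ) : Prop :=
  ∃ U : Fin k → Set (X × X),
    (∀ i, IsOpen (U i)) ∧ (⋃ i, U i) = univ ∧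
    ∀ i, ∃ s : C(U i, C(unitInterval, X)),
      ∀ u : U i, (s u 0, s u 1) = (u : X × X)

/-- The (unreduced) topological complexity of `X`, as an extended natural number. -/
noncomputable def TC (X : Type*) [TopologicalSpace X] : ℕ∞ :=
  sInf {k : ℕ∞ | ∃ m : ℕ, k = m ∧ HasMPCover X m}

/-- Complex projective `n`-space: the quotient of the nonzero vectors of `ℂ^{n+1}`
by the scalar action of `ℂ`. -/
def CP (n : ℕ) : Type :=
  Quot (fun v w : {v : Fin (n + 1) → ℂ // v ≠ 0} =>
    ∃ c : ℂ, (w : Fin (n + 1) → ℂ) = c • (v : Fin (n + 1) → ℂ))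

noncomputable instance (n : ℕ) : TopologicalSpace (CP n) := by
  unfold CP; infer_instance

/-- The complex-conjugation involution `[z_0 : ⋯ : z_n] ↦ [z̄_0 : ⋯ : z̄_n]` of `ℂP^n`. -/
noncomputable def cpConj (n : ℕ) : CP n → CP n :=
  Quot.map
    (fun v => ⟨fun i => starRingEnd ℂ ((v : Fin (n + 1) → ℂ) i), by
      intro h0
      apply v.2
      funext i
      have := congrFun h0 i
      simpa using this⟩)
    (by
      rintro v w ⟨c, hc⟩
      refine ⟨starRingEnd ℂ c, ?_⟩
      funext i
      simp [hc, Pi.smul_apply, smul_eq_mul, map_mul])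

/-- The unit sphere `S^n ⊂ ℝ^{n+1}`. -/
abbrev Sph (n : ℕ) : Type :=
  (Metric.sphere (0 : EuclideanSpace ℝ (Fin (n + 1))) 1 : Set (EuclideanSpace ℝ (Fin (n + 1))))

/-- The antipodal involution of the sphere `S^n`. -/
noncomputable def negSph (n : ℕ) : Sph n → Sph n := fun x =>
  ⟨-(x : EuclideanSpace ℝ (Fin (n + 1))), by
    have hx : ‖(x : EuclideanSpace ℝ (Fin (n + 1)))‖ = 1 :=
      mem_sphere_zero_iff_norm.mp x.2
    simp [mem_sphere_zero_iff_norm, hx]⟩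

/-- The generalized projective product space `X(ℂP^n, n_1, …, n_r)`: the quotient of
`ℂP^n × S^{n_1} × ⋯ × S^{n_r}` by `(y, x_1, …, x_r) ∼ (τ(y), −x_1, …, −x_r)`,
where `τ` is complex conjugation. -/
def CPGPP (n r : ℕ) (m : Fin r → ℕ) : Type _ :=
  Quot (fun a b : CP n × (∀ i : Fin r, Sph (m i)) =>
    b = (cpConj n a.1, fun i => negSph (m i) (a.2 i)))

noncomputable instance (n r : ℕ) (m : Fin r → ℕ) : TopologicalSpace (CPGPP n r m) := by
  unfold CPGPP; infer_instance

/-! ### Transversal covers -/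

/-- Suppose that, for every block `b` of a finite family of blocks of functions, the positivity sets
of the functions in the block cover `Z`, and that all intersections of positivity sets, one from
each block, satisfy a property stable under passing to subsets and to disjoint unions of open sets.
Then `Z` has an open cover by `N - q + 1` sets with this property, where `N` is the number of
functions and `q` the number of blocks. -/
theorem exists_open_cover_of_blocks {Z β : Type*} [TopologicalSpace Z] [Fintype β]
    {κ : β → Type*} [∀ b, Fintype (κ b)] (f : ∀ b, κ b → Z → ℝ)
    (hf : ∀ b k, Continuous (f b k)) (hpos : ∀ b z, ∃ k, 0 < f b k z) (P : Set Z → Prop)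
    (hmono : ∀ U V, U ⊆ V → P V → P U)
    (hunion : ∀ 𝒲 : Set (Set Z), (∀ W ∈ 𝒲, IsOpen W) → 𝒲.PairwiseDisjoint id →
      (∀ W ∈ 𝒲, P W) → P (⋃₀ 𝒲))
    (hP : ∀ t : ∀ b, κ b, P {z | ∀ b, 0 < f b (t b) z}) :
    ∃ W : Fin ((∑ b, Fintype.card (κ b)) - Fintype.card β + 1) → Set Z,
      (∀ i, IsOpen (W i)) ∧ (⋃ i, W i) = univ ∧ ∀ i, P (W i) := by
  classical
  rcases isEmpty_or_nonempty Z with hZ | ⟨⟨z₀⟩⟩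
  · refine ⟨fun _ => ∅, fun _ => isOpen_empty, Subsingleton.elim _ _, fun _ => ?_⟩
    simpa using hunion ∅ (by simp) (by simp) (by simp)
  have hne : ∀ b, (Finset.univ : Finset (κ b)).Nonempty := fun b =>
    ⟨(hpos b z₀).choose, Finset.mem_univ _⟩
  let M : β → Z → ℝ := fun b z => Finset.univ.sup' (hne b) fun k => f b k z
  have hM : ∀ b, Continuous (M b) := fun b =>
    Continuous.finset_sup'_apply (hne b) fun k _ => hf b k
  have hfM : ∀ b k z, f b k z ≤ M b z := fun b k z =>
    Finset.le_sup' (fun k => f b k z) (Finset.mem_univ k)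
  have hMpos : ∀ b z, 0 < M b z := fun b z =>
    let ⟨k, hk⟩ := hpos b z
    hk.trans_le (hfM b k z)
  let g : (Σ b, κ b) → Z → ℝ := fun s z => f s.1 s.2 z / M s.1 z
  have hg : ∀ s, Continuous (g s) := fun s =>
    (hf s.1 s.2).div (hM s.1) fun z => (hMpos s.1 z).ne'
  have hg1 : ∀ s z, g s z ≤ 1 := fun s z =>
    (div_le_one (hMpos s.1 z)).2 (hfM s.1 s.2 z)
  have hgmax : ∀ b z, ∃ k, g ⟨b, k⟩ z = 1 := fun b z => by
    obtain ⟨k, -, hk⟩ := Finset.exists_mem_eq_sup' (hne b) fun k => f b k z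
    refine ⟨k, ?_⟩
    change f b k z / M b z = 1
    rw [← hk]
    exact div_self (hMpos b z).ne'
  let O : Finset (Σ b, κ b) → Set Z := fun S =>
    {z | ∀ s ∈ S, 0 < g s z ∧ ∀ t ∉ S, g t z < g s z}
  have hO : ∀ S, IsOpen (O S) := fun S => by
    have : O S = ⋂ s ∈ S, ({z | 0 < g s z} ∩ ⋂ t ∈ Sᶜ, {z | g t z < g s z}) := by
      ext z
      simp [O]
    rw [this]
    exact isOpen_biInter_finset fun s _ => (isOpen_lt continuous_const (hg s)).inter <|
      isOpen_biInter_finset fun t _ => isOpen_lt (hg t) (hg s)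
  have hdisj : ∀ S T : Finset (Σ b, κ b), S.card = T.card → S ≠ T → Disjoint (O S) (O T) := by
    intro S T hST hne
    rw [Set.disjoint_left]
    intro z hS hT
    obtain ⟨s, hs, hs'⟩ := Finset.not_subset.1 fun h =>
      hne (Finset.eq_of_subset_of_card_le h hST.ge)
    obtain ⟨t, ht, ht'⟩ := Finset.not_subset.1 fun h =>
      hne (Finset.eq_of_subset_of_card_le h hST.le).symm
    exact lt_asymm ((hS s hs).2 t ht') ((hT t ht).2 s hs')
  let 𝒮 : ℕ → Set (Finset (Σ b, κ b)) := fun p => {S | S.card = p ∧ ∀ b, ∃ k, ⟨b, k⟩ ∈ S}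
  refine ⟨fun i => ⋃₀ (O '' 𝒮 (Fintype.card β + i)), fun i => ?_, ?_, fun i => ?_⟩
  · refine isOpen_sUnion ?_
    rintro _ ⟨S, -, rfl⟩
    exact hO S
  · refine eq_univ_of_forall fun z => ?_
    choose k hk using fun b => hgmax b z
    let S : Finset (Σ b, κ b) := Finset.univ.filter fun s => g s z = 1
    have hmem : ∀ s, s ∈ S ↔ g s z = 1 := fun s => by simp [S]
    have hle : S.card ≤ ∑ b, Fintype.card (κ b) := by
      rw [← Fintype.card_sigma]
      exact Finset.card_le_univ S
    have hge : Fintype.card β ≤ S.card := by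
      rw [← Finset.card_univ]
      refine Finset.card_le_card_of_injOn (fun b => ⟨b, k b⟩) (fun b _ => ?_) fun b _ c _ h => ?_
      · exact (hmem _).2 (hk b)
      · exact congrArg Sigma.fst h
    refine mem_iUnion.2 ⟨⟨S.card - Fintype.card β, by omega⟩, O S, ⟨S, ⟨?_, fun b => ?_⟩, rfl⟩, ?_⟩
    · simp only
      omega
    · exact ⟨k b, (hmem _).2 (hk b)⟩
    · intro s hs
      rw [(hmem s).1 hs]
      exact ⟨one_pos, fun t ht => lt_of_le_of_ne (hg1 t z) fun h => ht ((hmem t).2 h)⟩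
  · refine hunion _ ?_ ?_ ?_
    · rintro _ ⟨S, -, rfl⟩
      exact hO S
    · rintro _ ⟨S, hS, rfl⟩ _ ⟨T, hT, rfl⟩ hne
      exact hdisj S T (hS.1.trans hT.1.symm) fun h => hne (congrArg O h)
    · rintro _ ⟨S, hS, rfl⟩
      choose t ht using hS.2
      refine hmono (O S) {z | ∀ b, 0 < f b (t b) z} (fun z hz b => ?_) (hP t)
      have := (hz _ (ht b)).1
      exact (div_pos_iff_of_pos_right (hMpos b z)).1 this

/-! ### Homotopies on a subset -/

section Homotopy

open scoped unitInterval

theorem restrict_homotopic_iff {Z X : Type*} [TopologicalSpace Z] [TopologicalSpace X]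
    {a b : C(Z, X)} {U : Set Z} :
    (a.restrict U).Homotopic (b.restrict U) ↔ ∃ H : I × Z → X, ContinuousOn H (univ ×ˢ U) ∧
      ∀ z ∈ U, H (0, z) = a z ∧ H (1, z) = b z := by
  classical
  constructor
  · rintro ⟨F⟩
    refine ⟨fun p => if h : p.2 ∈ U then F (p.1, ⟨p.2, h⟩) else a p.2, ?_, fun z hz => ?_⟩
    · rw [continuousOn_iff_continuous_domRestrict]
      have : Continuous fun p : (univ ×ˢ U : Set (I × Z)) =>
          F ((p : I × Z).1, ⟨(p : I × Z).2, p.2.2⟩) := by fun_prop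
      refine this.congr fun p => ?_
      have hp : (p : I × Z).2 ∈ U := p.2.2
      simp [hp]
    · simp [hz]
  · rintro ⟨H, hH, h⟩
    refine ⟨⟨⟨fun p => H (p.1, p.2), ?_⟩, fun z => (h z z.2).1, fun z => (h z z.2).2⟩⟩
    exact hH.comp_continuous (by fun_prop) fun p => ⟨mem_univ _, p.2.2⟩

theorem restrict_homotopic_mono {Z X : Type*} [TopologicalSpace Z] [TopologicalSpace X]
    {a b : C(Z, X)} {U V : Set Z} (hUV : U ⊆ V)
    (h : (a.restrict V).Homotopic (b.restrict V)) : (a.restrict U).Homotopic (b.restrict U) := by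
  rw [restrict_homotopic_iff] at h ⊢
  obtain ⟨H, hH, h⟩ := h
  exact ⟨H, hH.mono (prod_mono subset_rfl hUV), fun z hz => h z (hUV hz)⟩

theorem restrict_homotopic_sUnion {Z X : Type*} [TopologicalSpace Z] [TopologicalSpace X]
    {a b : C(Z, X)} {𝒲 : Set (Set Z)} (ho : ∀ W ∈ 𝒲, IsOpen W) (hd : 𝒲.PairwiseDisjoint id)
    (h : ∀ W ∈ 𝒲, (a.restrict W).Homotopic (b.restrict W)) :
    (a.restrict (⋃₀ 𝒲)).Homotopic (b.restrict (⋃₀ 𝒲)) := by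
  classical
  simp only [restrict_homotopic_iff] at h ⊢
  have : Nonempty (I × Z → X) := ⟨fun p => a p.2⟩
  choose! H hH h0 using h
  let c : Z → Set Z := fun z => if hz : ∃ W ∈ 𝒲, z ∈ W then hz.choose else ∅
  have hc : ∀ W ∈ 𝒲, ∀ z ∈ W, c z = W := by
    intro W hW z hz
    have hex : ∃ W ∈ 𝒲, z ∈ W := ⟨W, hW, hz⟩
    simp only [c, dif_pos hex]
    exact hd.elim hex.choose_spec.1 hW (not_disjoint_iff.2 ⟨z, hex.choose_spec.2, hz⟩)
  refine ⟨fun p => H (c p.2) p, ?_, ?_⟩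
  · rintro ⟨t, z⟩ ⟨-, W, hW, hz⟩
    have hopen : IsOpen (univ ×ˢ W : Set (I × Z)) := isOpen_univ.prod (ho W hW)
    have hmem : (univ ×ˢ W : Set (I × Z)) ∈ nhds (t, z) := hopen.mem_nhds ⟨mem_univ _, hz⟩
    refine ((hH W hW).continuousAt hmem |>.congr ?_).continuousWithinAt
    filter_upwards [hmem] with p hp
    rw [hc W hW p.2 hp.2]
  · rintro z ⟨W, hW, hz⟩
    simp only
    rw [hc W hW z hz]
    exact h0 W hW z hz

/-- A homotopy between the two projections on `U` is a motion planner on `U`. -/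
theorem exists_motionPlanner_of_homotopic {X : Type*} [TopologicalSpace X] {U : Set (X × X)}
    (h : ((ContinuousMap.fst : C(X × X, X)).restrict U).Homotopic
      ((ContinuousMap.snd : C(X × X, X)).restrict U)) :
    ∃ s : C(U, C(I, X)), ∀ u : U, (s u 0, s u 1) = (u : X × X) := by
  obtain ⟨F⟩ := h
  refine ⟨(F.toContinuousMap.comp ContinuousMap.prodSwap).curry, fun u => ?_⟩
  exact Prod.ext (F.apply_zero u) (F.apply_one u)

/-- A finite family of blocks of functions such that all intersections of positivity sets, one from
each block, are contractible in `X`, yields a motion planning cover of `X`. -/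
theorem hasMPCover_of_blocks {X β : Type*} [TopologicalSpace X] [PathConnectedSpace X] [Fintype β]
    {κ : β → Type*} [∀ b, Fintype (κ b)] (f : ∀ b, κ b → X → ℝ)
    (hf : ∀ b k, Continuous (f b k)) (hpos : ∀ b x, ∃ k, 0 < f b k x)
    (hP : ∀ t : ∀ b, κ b, ∃ x₀ : X,
      ((ContinuousMap.id X).restrict {x | ∀ b, 0 < f b (t b) x}).Homotopic
        ((ContinuousMap.const X x₀).restrict {x | ∀ b, 0 < f b (t b) x})) :
    HasMPCover X (2 * (∑ b, Fintype.card (κ b)) - 2 * Fintype.card β + 1) := by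
  let pr : Bool → C(X × X, X) := fun e => bif e then ContinuousMap.snd else ContinuousMap.fst
  obtain ⟨W, hWo, hWc, hW⟩ := exists_open_cover_of_blocks (Z := X × X) (β := Bool × β)
    (κ := fun b => κ b.2) (fun b k z => f b.2 k (pr b.1 z))
    (fun b k => (hf b.2 k).comp (pr b.1).continuous) (fun b z => hpos b.2 _)
    (fun U => ((ContinuousMap.fst : C(X × X, X)).restrict U).Homotopic
      ((ContinuousMap.snd : C(X × X, X)).restrict U))
    (fun U V => restrict_homotopic_mono) (fun 𝒲 => restrict_homotopic_sUnion) (by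
      intro t
      set U := {z : X × X | ∀ b : Bool × β, 0 < f b.2 (t b) (pr b.1 z)}
      have key : ∀ e, ∃ x₀ : X, ((pr e).restrict U).Homotopic (ContinuousMap.const U x₀) := by
        intro e
        obtain ⟨x₀, hx₀⟩ := hP fun b => t (e, b)
        refine ⟨x₀, ?_⟩
        let φ : C(U, {x | ∀ b, 0 < f b (t (e, b)) x}) :=
          ⟨fun u => ⟨pr e u, fun b => u.2 (e, b)⟩, by fun_prop⟩
        exact hx₀.comp (.refl φ)
      obtain ⟨x₀, hx₀⟩ := key false
      obtain ⟨x₁, hx₁⟩ := key true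
      refine hx₀.trans (.trans ?_ hx₁.symm)
      let γ := (PathConnectedSpace.joined x₀ x₁).somePath
      exact ⟨⟨⟨fun p => γ p.1, by fun_prop⟩, fun _ => γ.source, fun _ => γ.target⟩⟩)
  have hcard : (∑ b : Bool × β, Fintype.card (κ b.2)) - Fintype.card (Bool × β) + 1 =
      2 * (∑ b, Fintype.card (κ b)) - 2 * Fintype.card β + 1 := by
    rw [Fintype.sum_prod_type]
    simp [two_mul]
  rw [← hcard]
  exact ⟨W, hWo, hWc, fun i => exists_motionPlanner_of_homotopic (hW i)⟩

end Homotopy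

/-! ### Complex projective space -/

/-- Nonzero vectors of `ℂ^{n+1}`. -/
abbrev NonzeroVec (n : ℕ) : Type := {v : Fin (n + 1) → ℂ // v ≠ 0}

/-- The point of `ℂP^n` with given homogeneous coordinates. -/
def CP.mk {n : ℕ} (v : NonzeroVec n) : CP n := Quot.mk _ v

theorem CP.mk_eq_mk_of_smul {n : ℕ} {v w : NonzeroVec n} (c : ℂ)
    (h : (w : Fin (n + 1) → ℂ) = c • (v : Fin (n + 1) → ℂ)) : CP.mk v = CP.mk w :=
  Quot.sound ⟨c, h⟩

theorem CP.exists_smul_of_mk_eq_mk {n : ℕ} {v w : NonzeroVec n} (h : CP.mk v = CP.mk w) :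
    ∃ c : ℂ, c ≠ 0 ∧ (w : Fin (n + 1) → ℂ) = c • (v : Fin (n + 1) → ℂ) := by
  have h' := Quot.eqvGen_exact h
  clear h
  induction h' with
  | rel v w h =>
    obtain ⟨c, hc⟩ := h
    refine ⟨c, ?_, hc⟩
    rintro rfl
    exact w.2 (by simpa using hc)
  | refl v => exact ⟨1, one_ne_zero, by simp⟩
  | symm v w h ih =>
    obtain ⟨c, hc0, hc⟩ := ih
    exact ⟨c⁻¹, inv_ne_zero hc0, by rw [hc, smul_smul, inv_mul_cancel₀ hc0, one_smul]⟩
  | trans u v w h₁ h₂ ih₁ ih₂ =>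
    obtain ⟨c, hc0, hc⟩ := ih₁
    obtain ⟨d, hd0, hd⟩ := ih₂
    exact ⟨d * c, mul_ne_zero hd0 hc0, by rw [hd, hc, smul_smul]⟩

theorem CP.isOpenQuotientMap_mk (n : ℕ) : IsOpenQuotientMap (CP.mk (n := n)) := by
  refine ⟨Quot.exists_rep, continuous_quot_mk, fun U hU => ?_⟩
  have hq : Topology.IsQuotientMap (CP.mk (n := n)) := isQuotientMap_quot_mk
  refine hq.isOpen_preimage.1 ?_
  let a : {c : ℂ // c ≠ 0} → NonzeroVec n → NonzeroVec n :=
    fun c v => ⟨(c : ℂ) • (v : Fin (n + 1) → ℂ), smul_ne_zero c.2 v.2⟩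
  have ha : ∀ c, Continuous (a c) := fun c =>
    (continuous_subtype_val.const_smul (c : ℂ)).subtype_mk _
  have : CP.mk ⁻¹' (CP.mk '' U) = ⋃ c, a c ⁻¹' U := by
    ext v
    simp only [mem_preimage, mem_image, mem_iUnion]
    constructor
    · rintro ⟨w, hw, hwv⟩
      obtain ⟨c, hc0, hc⟩ := CP.exists_smul_of_mk_eq_mk (v := v) hwv.symm
      refine ⟨⟨c, hc0⟩, ?_⟩
      rwa [show a ⟨c, hc0⟩ v = w from Subtype.ext hc.symm]
    · rintro ⟨c, hc⟩
      exact ⟨_, hc, (CP.mk_eq_mk_of_smul c rfl).symm⟩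
  rw [this]
  exact isOpen_iUnion fun c => hU.preimage (ha c)

instance (n : ℕ) : PathConnectedSpace (CP n) := by
  have hrank : 1 < Module.rank ℝ (Fin (n + 1) → ℂ) := by
    rw [← Module.finrank_eq_rank]
    norm_cast
    rw [Module.finrank_pi_fintype]
    simp only [Complex.finrank_real_complex, Finset.sum_const, Finset.card_univ, Fintype.card_fin,
      smul_eq_mul]
    omega
  have : PathConnectedSpace (NonzeroVec n) :=
    isPathConnected_iff_pathConnectedSpace.1
      (isPathConnected_compl_singleton_of_one_lt_rank hrank 0)
  exact (CP.isOpenQuotientMap_mk n).surjective.pathConnectedSpace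
    (CP.isOpenQuotientMap_mk n).continuous

/-- Entrywise complex conjugation of a nonzero vector. -/
def NonzeroVec.conj {n : ℕ} (v : NonzeroVec n) : NonzeroVec n :=
  ⟨star v.1, fun h => v.2 (star_eq_zero.1 h)⟩

theorem cpConj_mk {n : ℕ} (v : NonzeroVec n) : cpConj n (CP.mk v) = CP.mk v.conj := rfl

theorem cpConj_cpConj {n : ℕ} (p : CP n) : cpConj n (cpConj n p) = p := by
  obtain ⟨v, rfl⟩ := (CP.isOpenQuotientMap_mk n).surjective p
  rw [cpConj_mk, cpConj_mk]
  exact congrArg CP.mk (Subtype.ext (star_star _))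

theorem continuous_cpConj (n : ℕ) : Continuous (cpConj n) :=
  (CP.isOpenQuotientMap_mk n).continuous_comp_iff.1 <|
    (CP.isOpenQuotientMap_mk n).continuous.comp (f := NonzeroVec.conj)
      (continuous_subtype_val.star.subtype_mk _)

/-- The normalized absolute value of a homogeneous coordinate. -/
noncomputable def cpCoord {n : ℕ} (l : Fin (n + 1)) : CP n → ℝ :=
  Quot.lift (fun v => ‖(v : Fin (n + 1) → ℂ) l‖ / ‖(v : Fin (n + 1) → ℂ)‖) (by
    rintro v w ⟨c, hc⟩
    have hc0 : ‖c‖ ≠ 0 := by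
      intro h
      exact w.2 (by simpa [norm_eq_zero.1 h] using hc)
    rw [hc, norm_smul, Pi.smul_apply, norm_smul, mul_div_mul_left _ _ hc0])

theorem cpCoord_mk {n : ℕ} (l : Fin (n + 1)) (v : NonzeroVec n) :
    cpCoord l (CP.mk v) = ‖(v : Fin (n + 1) → ℂ) l‖ / ‖(v : Fin (n + 1) → ℂ)‖ := rfl

theorem cpCoord_mk_pos {n : ℕ} {l : Fin (n + 1)} {v : NonzeroVec n} :
    0 < cpCoord l (CP.mk v) ↔ (v : Fin (n + 1) → ℂ) l ≠ 0 := by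
  rw [cpCoord_mk, div_pos_iff_of_pos_right (norm_pos_iff.2 v.2), norm_pos_iff]

theorem continuous_cpCoord {n : ℕ} (l : Fin (n + 1)) : Continuous (cpCoord l) := by
  refine (CP.isOpenQuotientMap_mk n).continuous_comp_iff.1 ?_
  refine Continuous.div (f := fun v : NonzeroVec n => ‖v.1 l‖) (g := fun v => ‖v.1‖)
    ((continuous_apply l).comp continuous_subtype_val).norm continuous_subtype_val.norm
    fun v => norm_ne_zero_iff.2 v.2

theorem cpCoord_cpConj {n : ℕ} (l : Fin (n + 1)) (p : CP n) :
    cpCoord l (cpConj n p) = cpCoord l p := by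
  obtain ⟨v, rfl⟩ := (CP.isOpenQuotientMap_mk n).surjective p
  rw [cpConj_mk, cpCoord_mk, cpCoord_mk]
  simp [NonzeroVec.conj]

theorem exists_cpCoord_pos {n : ℕ} (p : CP n) : ∃ l, 0 < cpCoord l p := by
  obtain ⟨v, rfl⟩ := (CP.isOpenQuotientMap_mk n).surjective p
  obtain ⟨l, hl⟩ := Function.ne_iff.1 v.2
  exact ⟨l, cpCoord_mk_pos.2 hl⟩

/-- The coordinate point `e_l` of `ℂP^n`. -/
def cpVertex {n : ℕ} (l : Fin (n + 1)) : CP n :=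
  CP.mk ⟨(Pi.single l 1 : Fin (n + 1) → ℂ), by simp⟩

theorem cpConj_cpVertex {n : ℕ} (l : Fin (n + 1)) : cpConj n (cpVertex l) = cpVertex l := by
  refine congrArg CP.mk (Subtype.ext ?_)
  change star (Pi.single l 1 : Fin (n + 1) → ℂ) = Pi.single l 1
  rw [← Pi.single_star, star_one]

/-- Scaling all coordinates but the `l`-th one by `1 - t`. -/
def shrinkOff {n : ℕ} (l : Fin (n + 1)) (t : ℝ) (v : Fin (n + 1) → ℂ) : Fin (n + 1) → ℂ :=
  fun i => if i = l then v i else ((1 - t : ℝ) : ℂ) * v i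

theorem shrinkOff_smul {n : ℕ} (l : Fin (n + 1)) (t : ℝ) (c : ℂ) (v : Fin (n + 1) → ℂ) :
    shrinkOff l t (c • v) = c • shrinkOff l t v := by
  funext i
  by_cases h : i = l
  · simp [shrinkOff, h]
  · simp [shrinkOff, h, mul_left_comm]

theorem shrinkOff_star {n : ℕ} (l : Fin (n + 1)) (t : ℝ) (v : Fin (n + 1) → ℂ) :
    shrinkOff l t (star v) = star (shrinkOff l t v) := by
  funext i
  by_cases h : i = l
  · simp [shrinkOff, h]
  · simp [shrinkOff, h, mul_comm]

theorem shrinkOff_ne_zero {n : ℕ} {l : Fin (n + 1)} {v : Fin (n + 1) → ℂ} (t : ℝ) (h : v l ≠ 0) :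
    shrinkOff l t v ≠ 0 := fun h0 => h (by simpa [shrinkOff] using congrFun h0 l)

open Classical in
/-- `shrinkOff`, as a self-map of the nonzero vectors; vectors that would become zero stay put. -/
noncomputable def NonzeroVec.shrinkOff {n : ℕ} (l : Fin (n + 1)) (t : ℝ) (v : NonzeroVec n) :
    NonzeroVec n :=
  if h : Paper.shrinkOff l t v.1 = 0 then v else ⟨Paper.shrinkOff l t v.1, h⟩

theorem NonzeroVec.coe_shrinkOff {n : ℕ} {l : Fin (n + 1)} {v : NonzeroVec n} (t : ℝ)
    (h : v.1 l ≠ 0) : (v.shrinkOff l t : Fin (n + 1) → ℂ) = Paper.shrinkOff l t v.1 := by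
  rw [NonzeroVec.shrinkOff, dif_neg (shrinkOff_ne_zero t h)]

/-- The deformation of `ℂP^n` induced by `shrinkOff`. -/
noncomputable def cpStep {n : ℕ} (l : Fin (n + 1)) (t : ℝ) : CP n → CP n :=
  Quot.map (NonzeroVec.shrinkOff l t) (by
    rintro v w ⟨c, hc⟩
    have hc0 : c ≠ 0 := by
      rintro rfl
      exact w.2 (by simpa using hc)
    refine ⟨c, ?_⟩
    by_cases h : shrinkOff l t v.1 = 0
    · have h' : shrinkOff l t w.1 = 0 := by rw [hc, shrinkOff_smul, h, smul_zero]
      rw [NonzeroVec.shrinkOff, NonzeroVec.shrinkOff, dif_pos h, dif_pos h', hc]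
    · have h' : shrinkOff l t w.1 ≠ 0 := by
        rw [hc, shrinkOff_smul]
        exact smul_ne_zero hc0 h
      rw [NonzeroVec.shrinkOff, NonzeroVec.shrinkOff, dif_neg h, dif_neg h']
      simp only [hc, shrinkOff_smul])

theorem cpStep_mk {n : ℕ} (l : Fin (n + 1)) (t : ℝ) (v : NonzeroVec n) :
    cpStep l t (CP.mk v) = CP.mk (v.shrinkOff l t) := rfl

theorem cpStep_cpConj {n : ℕ} (l : Fin (n + 1)) (t : ℝ) (p : CP n) :
    cpStep l t (cpConj n p) = cpConj n (cpStep l t p) := by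
  obtain ⟨v, rfl⟩ := (CP.isOpenQuotientMap_mk n).surjective p
  simp only [cpConj_mk, cpStep_mk]
  refine congrArg CP.mk (Subtype.ext ?_)
  by_cases h : shrinkOff l t v.1 = 0
  · have h' : shrinkOff l t v.conj.1 = 0 := by
      rw [NonzeroVec.conj, shrinkOff_star, h, star_zero]
    rw [NonzeroVec.shrinkOff, NonzeroVec.shrinkOff, dif_pos h, dif_pos h']
  · have h' : shrinkOff l t v.conj.1 ≠ 0 := by
      rw [NonzeroVec.conj, shrinkOff_star]
      exact fun h0 => h (star_eq_zero.1 h0)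
    rw [NonzeroVec.shrinkOff, NonzeroVec.shrinkOff, dif_neg h, dif_neg h']
    exact shrinkOff_star l t v.1

theorem cpStep_zero {n : ℕ} {l : Fin (n + 1)} {p : CP n} (h : 0 < cpCoord l p) :
    cpStep l 0 p = p := by
  obtain ⟨v, rfl⟩ := (CP.isOpenQuotientMap_mk n).surjective p
  rw [cpStep_mk]
  refine congrArg CP.mk (Subtype.ext ?_)
  rw [NonzeroVec.coe_shrinkOff 0 (cpCoord_mk_pos.1 h)]
  funext i
  simp [shrinkOff]

theorem cpStep_one {n : ℕ} {l : Fin (n + 1)} {p : CP n} (h : 0 < cpCoord l p) :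
    cpStep l 1 p = cpVertex l := by
  obtain ⟨v, rfl⟩ := (CP.isOpenQuotientMap_mk n).surjective p
  rw [cpStep_mk]
  refine (CP.mk_eq_mk_of_smul (v.1 l) ?_).symm
  rw [NonzeroVec.coe_shrinkOff 1 (cpCoord_mk_pos.1 h)]
  funext i
  by_cases hi : i = l
  · subst hi
    simp [shrinkOff]
  · simp [shrinkOff, hi]

theorem continuousAt_cpStep {n : ℕ} {l : Fin (n + 1)} (t : ℝ) {p : CP n} (h : 0 < cpCoord l p) :
    ContinuousAt (fun q : ℝ × CP n => cpStep l q.1 q.2) (t, p) := by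
  obtain ⟨v, rfl⟩ := (CP.isOpenQuotientMap_mk n).surjective p
  refine (IsOpenQuotientMap.id.prodMap (CP.isOpenQuotientMap_mk n)).continuousAt_comp_iff
    (x := (t, v)).1 ?_
  refine (CP.isOpenQuotientMap_mk n).continuous.continuousAt.comp
    (f := fun q : ℝ × NonzeroVec n => q.2.shrinkOff l q.1) ?_
  refine Topology.IsInducing.subtypeVal.continuousAt_iff.2 ?_
  have hcont : Continuous fun q : ℝ × NonzeroVec n => shrinkOff l q.1 q.2.1 := by
    have hcoord : ∀ i, Continuous fun q : ℝ × NonzeroVec n => q.2.1 i := fun i =>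
      (continuous_apply i).comp (continuous_subtype_val.comp continuous_snd)
    refine continuous_pi fun i => ?_
    by_cases hi : i = l
    · simp only [shrinkOff, if_pos hi]
      exact hcoord i
    · simp only [shrinkOff, if_neg hi]
      exact Continuous.mul (by fun_prop) (hcoord i)
  refine hcont.continuousAt.congr ?_
  have hopen : IsOpen {q : ℝ × NonzeroVec n | q.2.1 l ≠ 0} :=
    isOpen_ne_fun ((continuous_apply l).comp (continuous_subtype_val.comp continuous_snd))
      continuous_const
  filter_upwards [hopen.mem_nhds (x := (t, v)) (cpCoord_mk_pos.1 h)] with q hq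
  exact (NonzeroVec.coe_shrinkOff q.1 hq).symm

/-! ### Spheres -/

instance {m : ℕ} [hm : Fact (1 ≤ m)] : PathConnectedSpace (Sph m) := by
  refine isPathConnected_iff_pathConnectedSpace.1 (isPathConnected_sphere ?_ 0 zero_le_one)
  rw [← Module.finrank_eq_rank]
  norm_cast
  rw [finrank_euclideanSpace_fin]
  have := hm.out
  omega

theorem Sph.norm_coe {m : ℕ} (x : Sph m) : ‖(x : EuclideanSpace ℝ (Fin (m + 1)))‖ = 1 :=
  mem_sphere_zero_iff_norm.1 x.2

open Classical in
/-- The radial projection to the sphere of the point `(1 - t) x + t w`; this is `x` by convention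
if that point is the origin. -/
noncomputable def sphStep {m : ℕ} (t : ℝ) (x : Sph m) (w : EuclideanSpace ℝ (Fin (m + 1))) :
    Sph m :=
  if h : (1 - t) • (x : EuclideanSpace ℝ (Fin (m + 1))) + t • w = 0 then x else
    ⟨‖(1 - t) • (x : EuclideanSpace ℝ (Fin (m + 1))) + t • w‖⁻¹ •
      ((1 - t) • (x : EuclideanSpace ℝ (Fin (m + 1))) + t • w), by
      rw [mem_sphere_zero_iff_norm, norm_smul, norm_inv, norm_norm,
        inv_mul_cancel₀ (norm_ne_zero_iff.2 h)]⟩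

theorem coe_sphStep {m : ℕ} {t : ℝ} {x : Sph m} {w : EuclideanSpace ℝ (Fin (m + 1))}
    (h : (1 - t) • (x : EuclideanSpace ℝ (Fin (m + 1))) + t • w ≠ 0) :
    (sphStep t x w : EuclideanSpace ℝ (Fin (m + 1))) =
      ‖(1 - t) • (x : EuclideanSpace ℝ (Fin (m + 1))) + t • w‖⁻¹ •
        ((1 - t) • (x : EuclideanSpace ℝ (Fin (m + 1))) + t • w) := by
  rw [sphStep, dif_neg h]

theorem sphStep_neg {m : ℕ} (t : ℝ) (x : Sph m) (w : EuclideanSpace ℝ (Fin (m + 1))) :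
    sphStep t (-x) (-w) = -sphStep t x w := by
  have key : (1 - t) • ((-x : Sph m) : EuclideanSpace ℝ (Fin (m + 1))) + t • -w =
      -((1 - t) • (x : EuclideanSpace ℝ (Fin (m + 1))) + t • w) := by
    rw [coe_neg_sphere]
    module
  by_cases h : (1 - t) • (x : EuclideanSpace ℝ (Fin (m + 1))) + t • w = 0
  · rw [sphStep, sphStep, dif_pos h, dif_pos (by rw [key, h, neg_zero])]
  · refine Subtype.ext ?_
    rw [coe_neg_sphere, coe_sphStep h, coe_sphStep (by rw [key]; exact neg_ne_zero.2 h), key,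
      norm_neg, smul_neg]

theorem sphStep_zero {m : ℕ} (x : Sph m) (w : EuclideanSpace ℝ (Fin (m + 1))) :
    sphStep 0 x w = x := by
  have h : (1 - 0 : ℝ) • (x : EuclideanSpace ℝ (Fin (m + 1))) + (0 : ℝ) • w = x := by module
  refine Subtype.ext ?_
  rw [coe_sphStep (by rw [h, ← norm_ne_zero_iff, x.norm_coe]; exact one_ne_zero), h, x.norm_coe,
    inv_one, one_smul]

theorem sphStep_one {m : ℕ} (x y : Sph m) {a : ℝ} (ha : 0 < a) :
    sphStep 1 x (a • (y : EuclideanSpace ℝ (Fin (m + 1)))) = y := by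
  have h : (1 - 1 : ℝ) • (x : EuclideanSpace ℝ (Fin (m + 1))) +
      (1 : ℝ) • a • (y : EuclideanSpace ℝ (Fin (m + 1))) = a • y := by module
  have hn : ‖a • (y : EuclideanSpace ℝ (Fin (m + 1)))‖ = a := by
    rw [norm_smul, y.norm_coe, mul_one, Real.norm_of_nonneg ha.le]
  refine Subtype.ext ?_
  rw [coe_sphStep (by rw [h, ← norm_ne_zero_iff, hn]; exact ha.ne'), h, hn, smul_smul,
    inv_mul_cancel₀ ha.ne', one_smul]

theorem continuousAt_sphStep {m : ℕ} {t : ℝ} {x : Sph m} {w : EuclideanSpace ℝ (Fin (m + 1))}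
    (h : (1 - t) • (x : EuclideanSpace ℝ (Fin (m + 1))) + t • w ≠ 0) :
    ContinuousAt (fun q : ℝ × Sph m × EuclideanSpace ℝ (Fin (m + 1)) => sphStep q.1 q.2.1 q.2.2)
      (t, x, w) := by
  let u : ℝ × Sph m × EuclideanSpace ℝ (Fin (m + 1)) → EuclideanSpace ℝ (Fin (m + 1)) :=
    fun q => (1 - q.1) • (q.2.1 : EuclideanSpace ℝ (Fin (m + 1))) + q.1 • q.2.2
  have hu : Continuous u := by fun_prop
  refine Topology.IsInducing.subtypeVal.continuousAt_iff.2 ?_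
  have hc : ContinuousAt (fun q => ‖u q‖⁻¹ • u q) (t, x, w) :=
    (hu.norm.continuousAt.inv₀ (norm_ne_zero_iff.2 h)).smul hu.continuousAt
  refine hc.congr ?_
  filter_upwards [hu.continuousAt.eventually_ne h] with q hq
  exact (coe_sphStep hq).symm

theorem lineMap_sph_ne_zero {m : ℕ} {x y : Sph m}
    (h : (x : EuclideanSpace ℝ (Fin (m + 1))) + y ≠ 0) (t : ℝ) :
    (1 - t) • (x : EuclideanSpace ℝ (Fin (m + 1))) +
      t • (y : EuclideanSpace ℝ (Fin (m + 1))) ≠ 0 := by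
  intro h0
  have h1 := congrArg norm (eq_neg_of_add_eq_zero_left h0)
  rw [norm_neg, norm_smul, norm_smul, x.norm_coe, y.norm_coe, mul_one, mul_one, Real.norm_eq_abs,
    Real.norm_eq_abs, ← sq_eq_sq_iff_abs_eq_abs] at h1
  have ht : t = 1 / 2 := by linarith
  refine h ?_
  have : (x : EuclideanSpace ℝ (Fin (m + 1))) + (y : EuclideanSpace ℝ (Fin (m + 1))) =
      (2 : ℝ) • ((1 - t) • (x : EuclideanSpace ℝ (Fin (m + 1))) +
        t • (y : EuclideanSpace ℝ (Fin (m + 1)))) := by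
    rw [ht]
    module
  rw [this, h0, smul_zero]

/-- The `j`-th standard basis vector, as a point of the sphere. -/
noncomputable def sphVertex {m : ℕ} (j : Fin (m + 1)) : Sph m :=
  ⟨EuclideanSpace.single j 1, by simp⟩

theorem lineMap_sphVertex_ne_zero {m : ℕ} {x : Sph m} {j : Fin (m + 1)} (h : x.1 j ≠ 0) (t : ℝ) :
    (1 - t) • (x : EuclideanSpace ℝ (Fin (m + 1))) +
      t • x.1 j • (sphVertex j : EuclideanSpace ℝ (Fin (m + 1))) ≠ 0 := by
  intro h0
  have := congrArg (fun v : EuclideanSpace ℝ (Fin (m + 1)) => v j) h0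
  simp only [sphVertex, PiLp.add_apply, PiLp.smul_apply, PiLp.single_apply, smul_eq_mul,
    PiLp.zero_apply, if_true] at this
  exact h (by linarith)

/-- The standard isometric inclusion `ℝ^{a+1} → ℝ^{b+1}` for `a ≤ b`. -/
noncomputable def euclideanIncl {a b : ℕ} (h : a ≤ b) :
    EuclideanSpace ℝ (Fin (a + 1)) →ₗᵢ[ℝ] EuclideanSpace ℝ (Fin (b + 1)) :=
  LinearMap.isometryOfOrthonormal
    ((EuclideanSpace.basisFun (Fin (a + 1)) ℝ).toBasis.constr ℝ
      (EuclideanSpace.basisFun (Fin (b + 1)) ℝ ∘ Fin.castLE (Nat.succ_le_succ h)))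
    (v := (EuclideanSpace.basisFun (Fin (a + 1)) ℝ).toBasis)
    (by simp)
    (by
      have : ⇑((EuclideanSpace.basisFun (Fin (a + 1)) ℝ).toBasis.constr ℝ
          (EuclideanSpace.basisFun (Fin (b + 1)) ℝ ∘ Fin.castLE (Nat.succ_le_succ h))) ∘
          (EuclideanSpace.basisFun (Fin (a + 1)) ℝ).toBasis =
          EuclideanSpace.basisFun (Fin (b + 1)) ℝ ∘ Fin.castLE (Nat.succ_le_succ h) := by
        funext i
        exact Module.Basis.constr_basis _ _ _ _
      rw [this]
      exact (EuclideanSpace.basisFun (Fin (b + 1)) ℝ).orthonormal.comp _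
        (Fin.castLE_injective _))

theorem euclideanIncl_refl {a : ℕ} (h : a ≤ a) (x : EuclideanSpace ℝ (Fin (a + 1))) :
    euclideanIncl h x = x := by
  have : (EuclideanSpace.basisFun (Fin (a + 1)) ℝ).toBasis.constr ℝ
      (EuclideanSpace.basisFun (Fin (a + 1)) ℝ ∘ Fin.castLE (Nat.succ_le_succ h)) =
      LinearMap.id := by
    refine (EuclideanSpace.basisFun (Fin (a + 1)) ℝ).toBasis.ext fun i => ?_
    rw [Module.Basis.constr_basis]
    simp
  exact LinearMap.congr_fun this x

/-- The standard inclusion of spheres `S^a → S^b` for `a ≤ b`, composed with the antipodal map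
if `e` is `true`. -/
noncomputable def signedIncl {a b : ℕ} (h : a ≤ b) (e : Bool) (x : Sph a) : Sph b :=
  let y : Sph b := ⟨euclideanIncl h x.1, by
    rw [mem_sphere_zero_iff_norm, LinearIsometry.norm_map, x.norm_coe]⟩
  bif e then -y else y

theorem coe_signedIncl {a b : ℕ} (h : a ≤ b) (e : Bool) (x : Sph a) :
    (signedIncl h e x : EuclideanSpace ℝ (Fin (b + 1))) =
      bif e then -euclideanIncl h x.1 else euclideanIncl h x.1 := by
  cases e <;> rfl

theorem signedIncl_neg {a b : ℕ} (h : a ≤ b) (e : Bool) (x : Sph a) :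
    signedIncl h e (-x) = -signedIncl h e x := by
  refine Subtype.ext ?_
  cases e <;> simp [coe_signedIncl]

theorem signedIncl_refl {a : ℕ} (h : a ≤ a) (x : Sph a) : signedIncl h false x = x :=
  Subtype.ext (euclideanIncl_refl h x.1)

theorem continuous_signedIncl {a b : ℕ} (h : a ≤ b) (e : Bool) : Continuous (signedIncl h e) := by
  refine Topology.IsInducing.subtypeVal.continuous_iff.2 ?_
  have hc : Continuous fun x : Sph a => euclideanIncl h x.1 :=
    (euclideanIncl h).continuous.comp continuous_subtype_val
  cases e
  · exact hc
  · exact hc.neg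

theorem exists_add_signedIncl_ne_zero {a b : ℕ} (h : a ≤ b) (x : Sph a) (y : Sph b) :
    ∃ e, (y : EuclideanSpace ℝ (Fin (b + 1))) + signedIncl h e x ≠ 0 := by
  by_contra! hcon
  have h1 := hcon true
  have h2 := hcon false
  simp only [coe_signedIncl, cond_true, cond_false] at h1 h2
  have h3 : (2 : ℝ) • (y : EuclideanSpace ℝ (Fin (b + 1))) = 0 := by
    refine Eq.trans ?_ ((congrArg₂ (· + ·) h1 h2).trans (add_zero 0))
    module
  have h4 := y.norm_coe
  rw [(smul_eq_zero.1 h3).resolve_left two_ne_zero, norm_zero] at h4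
  exact zero_ne_one h4

/-! ### Generalized projective product spaces -/

section CPGPP

variable {n r : ℕ} {m : Fin r → ℕ}

/-- The total space of the double cover defining `CPGPP n r m`. -/
abbrev CoverSpace (n r : ℕ) (m : Fin r → ℕ) : Type := CP n × ∀ i : Fin r, Sph (m i)

/-- The involution of `CoverSpace n r m`. -/
noncomputable def deck (a : CoverSpace n r m) : CoverSpace n r m := (cpConj n a.1, -a.2)

theorem deck_deck (a : CoverSpace n r m) : deck (deck a) = a :=
  Prod.ext (cpConj_cpConj a.1) (neg_neg a.2)

theorem continuous_deck : Continuous (deck : CoverSpace n r m → CoverSpace n r m) :=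
  ((continuous_cpConj n).comp continuous_fst).prodMk continuous_snd.neg

/-- The quotient map of `CPGPP n r m`. -/
def CPGPP.mk (a : CoverSpace n r m) : CPGPP n r m := Quot.mk _ a

theorem CPGPP.mk_deck (a : CoverSpace n r m) : CPGPP.mk (deck a) = CPGPP.mk a := by
  symm
  apply Quot.sound
  rfl

theorem CPGPP.eq_or_eq_deck {a b : CoverSpace n r m} (h : CPGPP.mk a = CPGPP.mk b) :
    b = a ∨ b = deck a := by
  have h' := Quot.eqvGen_exact h
  clear h
  induction h' with
  | rel a b h => exact .inr h
  | refl a => exact .inl rfl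
  | symm a b _ ih =>
    rcases ih with rfl | rfl
    · exact .inl rfl
    · exact .inr (deck_deck a).symm
  | trans a b c _ _ ih₁ ih₂ =>
    rcases ih₁ with rfl | rfl
    · exact ih₂
    · rcases ih₂ with rfl | rfl
      · exact .inr rfl
      · exact .inl (deck_deck a)

theorem CPGPP.isOpenQuotientMap_mk :
    IsOpenQuotientMap (CPGPP.mk : CoverSpace n r m → CPGPP n r m) := by
  refine ⟨Quot.exists_rep, continuous_quot_mk, fun U hU => ?_⟩
  have hq : Topology.IsQuotientMap (CPGPP.mk : CoverSpace n r m → CPGPP n r m) :=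
    isQuotientMap_quot_mk
  refine hq.isOpen_preimage.1 ?_
  have : CPGPP.mk ⁻¹' (CPGPP.mk '' U) = U ∪ deck ⁻¹' U := by
    ext a
    constructor
    · rintro ⟨b, hb, hba⟩
      rcases CPGPP.eq_or_eq_deck hba.symm with rfl | rfl
      · exact .inl hb
      · exact .inr hb
    · rintro (h | h)
      · exact ⟨a, h, rfl⟩
      · exact ⟨_, h, CPGPP.mk_deck a⟩
  rw [this]
  exact hU.union (hU.preimage continuous_deck)

theorem CPGPP.pathConnectedSpace (hm : ∀ i, 1 ≤ m i) : PathConnectedSpace (CPGPP n r m) := by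
  have : ∀ i, Fact (1 ≤ m i) := fun i => ⟨hm i⟩
  exact CPGPP.isOpenQuotientMap_mk.surjective.pathConnectedSpace
    CPGPP.isOpenQuotientMap_mk.continuous

/-- A continuous function on `CoverSpace n r m` invariant under `deck`, as a function on the
quotient. -/
def CPGPP.lift {T : Type*} (f : CoverSpace n r m → T) (hf : ∀ a, f (deck a) = f a) :
    CPGPP n r m → T :=
  Quot.lift f (by
    rintro a _ rfl
    exact (hf a).symm)

theorem CPGPP.continuous_lift {T : Type*} [TopologicalSpace T] {f : CoverSpace n r m → T}
    (hf : ∀ a, f (deck a) = f a) (hc : Continuous f) : Continuous (CPGPP.lift f hf) :=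
  CPGPP.isOpenQuotientMap_mk.continuous_comp_iff.1 hc

open scoped unitInterval in
/-- An equivariant deformation of `CoverSpace n r m`, continuous over `U`, induces a homotopy
on `U`. -/
theorem CPGPP.restrict_homotopic_of_equivariant {a b : C(CPGPP n r m, CPGPP n r m)}
    {U : Set (CPGPP n r m)} (h : ℝ → CoverSpace n r m → CoverSpace n r m)
    (hdeck : ∀ t y, h t (deck y) = deck (h t y))
    (hcont : ∀ t y, CPGPP.mk y ∈ U →
      ContinuousAt (fun q : ℝ × CoverSpace n r m => h q.1 q.2) (t, y))
    (h0 : ∀ y, CPGPP.mk y ∈ U → CPGPP.mk (h 0 y) = a (CPGPP.mk y))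
    (h1 : ∀ y, CPGPP.mk y ∈ U → CPGPP.mk (h 1 y) = b (CPGPP.mk y)) :
    (a.restrict U).Homotopic (b.restrict U) := by
  rw [restrict_homotopic_iff]
  let H : ℝ → CPGPP n r m → CPGPP n r m := fun t =>
    CPGPP.lift (fun y => CPGPP.mk (h t y)) fun y => by rw [hdeck, CPGPP.mk_deck]
  refine ⟨fun p => H p.1 p.2, ?_, ?_⟩
  · rintro ⟨t, x⟩ ⟨-, hx⟩
    obtain ⟨y, rfl⟩ := CPGPP.isOpenQuotientMap_mk.surjective x
    refine ContinuousAt.continuousWithinAt ?_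
    refine (IsOpenQuotientMap.id.prodMap CPGPP.isOpenQuotientMap_mk).continuousAt_comp_iff
      (x := (t, y)).1 ?_
    refine CPGPP.isOpenQuotientMap_mk.continuous.continuousAt.comp
      (f := fun q : I × CoverSpace n r m => h q.1 q.2) ?_
    exact (hcont t y hx).comp_of_eq (f := fun q : I × CoverSpace n r m => ((q.1 : ℝ), q.2))
      (Continuous.continuousAt (by fun_prop)) rfl
  · intro x hx
    obtain ⟨y, rfl⟩ := CPGPP.isOpenQuotientMap_mk.surjective x
    exact ⟨h0 y hx, h1 y hx⟩

variable {i₀ : Fin r} (hi : ∀ i, m i₀ ≤ m i)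

/-- The equivariant embedding of `S^{m i₀}` over the vertex `e_l` of `ℂP^n`, whose components are
the inclusions with signs `e`. -/
noncomputable def sphEmb (l : Fin (n + 1)) (e : Fin r → Bool) (s : Sph (m i₀)) :
    CoverSpace n r m :=
  (cpVertex l, fun i => signedIncl (hi i) (e i) s)

theorem sphEmb_neg (l : Fin (n + 1)) (e : Fin r → Bool) (s : Sph (m i₀)) :
    sphEmb hi l e (-s) = deck (sphEmb hi l e s) :=
  Prod.ext (cpConj_cpVertex l).symm (funext fun i => signedIncl_neg (hi i) (e i) s)

theorem continuous_sphEmb (l : Fin (n + 1)) (e : Fin r → Bool) :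
    Continuous (sphEmb (n := n) hi l e) :=
  continuous_const.prodMk (continuous_pi fun i => continuous_signedIncl (hi i) (e i))

/-- The open set of points whose `l`-th projective coordinate and `j`-th coordinate on the sphere
with index `i₀` are nonzero, and whose other spherical components are not antipodal to the signed
image of the component with index `i₀`, is contractible in `CPGPP n r m`. -/
theorem CPGPP.restrict_id_homotopic_const (l : Fin (n + 1)) (j : Fin (m i₀ + 1)) (e : Fin r → Bool)
    {U : Set (CPGPP n r m)} (hl : ∀ y, CPGPP.mk y ∈ U → 0 < cpCoord l y.1)
    (hj : ∀ y, CPGPP.mk y ∈ U → (y.2 i₀).1 j ≠ 0)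
    (he : ∀ y i, CPGPP.mk y ∈ U → (y.2 i : EuclideanSpace ℝ (Fin (m i + 1))) +
      (signedIncl (hi i) (e i) (y.2 i₀) : EuclideanSpace ℝ (Fin (m i + 1))) ≠ 0) :
    ((ContinuousMap.id (CPGPP n r m)).restrict U).Homotopic
      ((ContinuousMap.const _ (CPGPP.mk (sphEmb hi l e (sphVertex j)))).restrict U) := by
  have hemb : Continuous fun y : CoverSpace n r m => sphEmb (n := n) hi l e (y.2 i₀) :=
    (continuous_sphEmb hi l e).comp (by fun_prop)
  let k : C(CPGPP n r m, CPGPP n r m) :=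
    ⟨CPGPP.lift (fun y => CPGPP.mk (sphEmb hi l e (y.2 i₀))) fun y => by
        rw [← CPGPP.mk_deck (sphEmb hi l e (y.2 i₀)), ← sphEmb_neg]
        rfl,
      CPGPP.continuous_lift _ (CPGPP.isOpenQuotientMap_mk.continuous.comp hemb)⟩
  have hk : ∀ y, k (CPGPP.mk y) = CPGPP.mk (sphEmb hi l e (y.2 i₀)) := fun y => rfl
  refine .trans (g := k.restrict U) ?_ ?_
  · refine CPGPP.restrict_homotopic_of_equivariant (fun t y => (cpStep l t y.1,
      fun i => sphStep t (y.2 i) (signedIncl (hi i) (e i) (y.2 i₀)).1)) ?_ ?_ ?_ ?_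
    · refine fun t y => Prod.ext (cpStep_cpConj l t y.1) (funext fun i => ?_)
      change sphStep t (-y.2 i) (signedIncl (hi i) (e i) (-y.2 i₀)).1 = -sphStep t _ _
      rw [signedIncl_neg, coe_neg_sphere, sphStep_neg]
    · intro t y hy
      refine ContinuousAt.prodMk ?_ (continuousAt_pi.2 fun i => ?_)
      · exact (continuousAt_cpStep t (hl y hy)).comp_of_eq
          (f := fun q : ℝ × CoverSpace n r m => (q.1, q.2.1))
          (Continuous.continuousAt (by fun_prop)) rfl
      · refine (continuousAt_sphStep (lineMap_sph_ne_zero (he y i hy) t)).comp_of_eq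
          (f := fun q : ℝ × CoverSpace n r m =>
            (q.1, q.2.2 i, (signedIncl (hi i) (e i) (q.2.2 i₀)).1)) (Continuous.continuousAt ?_) rfl
        have := continuous_signedIncl (hi i) (e i)
        fun_prop
    · intro y hy
      refine congrArg CPGPP.mk (Prod.ext (cpStep_zero (hl y hy)) (funext fun i => ?_))
      exact sphStep_zero _ _
    · intro y hy
      refine congrArg CPGPP.mk (Prod.ext (cpStep_one (hl y hy)) (funext fun i => ?_))
      have h := sphStep_one (y.2 i) (signedIncl (hi i) (e i) (y.2 i₀)) one_pos
      rwa [one_smul] at h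
  · refine CPGPP.restrict_homotopic_of_equivariant (fun t y => sphEmb hi l e
      (sphStep t (y.2 i₀) ((y.2 i₀).1 j • (sphVertex j).1))) ?_ ?_ ?_ ?_
    · intro t y
      rw [← sphEmb_neg, ← sphStep_neg, ← neg_smul]
      rfl
    · intro t y hy
      refine (continuous_sphEmb hi l e).continuousAt.comp
        (f := fun q : ℝ × CoverSpace n r m =>
          sphStep q.1 (q.2.2 i₀) ((q.2.2 i₀).1 j • (sphVertex j).1)) ?_
      refine (continuousAt_sphStep (lineMap_sphVertex_ne_zero (hj y hy) t)).comp_of_eq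
        (f := fun q : ℝ × CoverSpace n r m =>
          (q.1, q.2.2 i₀, (q.2.2 i₀).1 j • (sphVertex j).1)) (Continuous.continuousAt ?_) rfl
      have hproj : Continuous fun q : ℝ × CoverSpace n r m => (q.2.2 i₀).1 := by fun_prop
      fun_prop
    · intro y hy
      rw [sphStep_zero, hk]
    · intro y hy
      change _ = CPGPP.mk (sphEmb hi l e (sphVertex j))
      rcases lt_or_gt_of_ne (hj y hy) with h | h
      · have h' : (y.2 i₀).1 j • (sphVertex j).1 =
            (-(y.2 i₀).1 j) • (-sphVertex j : Sph (m i₀)).1 := by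
          rw [coe_neg_sphere, neg_smul, smul_neg, neg_neg]
        rw [h', sphStep_one _ _ (neg_pos.2 h), sphEmb_neg, CPGPP.mk_deck]
      · rw [sphStep_one _ _ h]

/-- The index types of the three kinds of functions in `blockFun`. -/
def Block (n k : ℕ) {J : Type} : Option (Option J) → Type
  | none => Fin (n + 1)
  | some none => Fin (k + 1)
  | some (some _) => Bool

instance (n k : ℕ) {J : Type} : ∀ b : Option (Option J), Fintype (Block n k b)
  | none => inferInstanceAs (Fintype (Fin (n + 1)))
  | some none => inferInstanceAs (Fintype (Fin (k + 1)))
  | some (some _) => inferInstanceAs (Fintype Bool)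

theorem sum_card_block (n k : ℕ) {J : Type} [Fintype J] :
    ∑ b : Option (Option J), Fintype.card (Block n k b) =
      (n + 1) + ((k + 1) + Fintype.card J * 2) := by
  have h0 : Fintype.card (Block n k (none : Option (Option J))) = n + 1 := Fintype.card_fin _
  have h1 : Fintype.card (Block n k (some none : Option (Option J))) = k + 1 := Fintype.card_fin _
  have h2 : ∀ i : J, Fintype.card (Block n k (some (some i))) = 2 := fun _ => Fintype.card_bool
  rw [Fintype.sum_option, Fintype.sum_option, h0, h1]
  simp [h2]

/-- The invariant functions whose positivity sets are used to cover `CPGPP n r m`: normalized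
projective coordinates, absolute coordinates on the sphere with index `i₀`, and the distances of the
other spherical components to the two images of the component with index `i₀`. -/
noncomputable def blockFun : ∀ b : Option (Option {i // i ≠ i₀}), Block n (m i₀) b →
    CoverSpace n r m → ℝ
  | none, l, y => cpCoord l y.1
  | some none, j, y => ‖(y.2 i₀).1 j‖
  | some (some i), e, y => ‖(y.2 i).1 + (signedIncl (hi i) e (y.2 i₀)).1‖

theorem blockFun_deck : ∀ (b : Option (Option {i // i ≠ i₀})) (k : Block n (m i₀) b)
    (y : CoverSpace n r m), blockFun hi b k (deck y) = blockFun hi b k y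
  | none, l, y => cpCoord_cpConj l y.1
  | some none, j, y => norm_neg ((y.2 i₀).1 j)
  | some (some i), e, y => by
    have key : ∀ e : Bool, ‖(-y.2 i : Sph (m i)).1 + (signedIncl (hi i) e (-y.2 i₀)).1‖ =
        ‖(y.2 i).1 + (signedIncl (hi i) e (y.2 i₀)).1‖ := fun e => by
      rw [signedIncl_neg, coe_neg_sphere, coe_neg_sphere, ← neg_add, norm_neg]
    exact key e

theorem continuous_blockFun : ∀ (b : Option (Option {i // i ≠ i₀})) (k : Block n (m i₀) b),
    Continuous (blockFun (n := n) hi b k)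
  | none, l => (continuous_cpCoord l).comp continuous_fst
  | some none, j => by
    have hproj : Continuous fun y : CoverSpace n r m => (y.2 i₀).1 := by fun_prop
    change Continuous fun y : CoverSpace n r m => ‖(y.2 i₀).1 j‖
    fun_prop
  | some (some i), e => by
    have := continuous_signedIncl (hi i) e
    change Continuous fun y : CoverSpace n r m => ‖(y.2 i).1 + (signedIncl (hi i) e (y.2 i₀)).1‖
    fun_prop

theorem exists_blockFun_pos : ∀ (b : Option (Option {i // i ≠ i₀})) (y : CoverSpace n r m),
    ∃ k, 0 < blockFun hi b k y
  | none, y => exists_cpCoord_pos y.1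
  | some none, y => by
    by_contra! h
    refine zero_ne_one (norm_zero.symm.trans ((congrArg norm ?_).trans (y.2 i₀).norm_coe))
    ext j
    exact (norm_le_zero_iff.1 (h j)).symm
  | some (some i), y => by
    obtain ⟨e, he⟩ := exists_add_signedIncl_ne_zero (hi i) (y.2 i₀) (y.2 i)
    exact ⟨e, norm_pos_iff.2 he⟩

theorem CPGPP.hasMPCover {i₀ : Fin r} (hi : ∀ i, m i₀ ≤ m i) (hm : ∀ i, 1 ≤ m i) :
    HasMPCover (CPGPP n r m) (2 * (m i₀ + r + n) - 1) := by
  have := CPGPP.pathConnectedSpace (n := n) hm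
  have hmp := hasMPCover_of_blocks (X := CPGPP n r m)
    (fun b k => CPGPP.lift (blockFun hi b k) (blockFun_deck hi b k))
    (fun b k => CPGPP.continuous_lift _ (continuous_blockFun hi b k))
    (fun b x => by
      obtain ⟨y, rfl⟩ := CPGPP.isOpenQuotientMap_mk.surjective x
      exact exists_blockFun_pos hi b y)
    (fun t => by
      classical
      let e : Fin r → Bool := fun i => if h : i = i₀ then false else t (some (some ⟨i, h⟩))
      refine ⟨_, CPGPP.restrict_id_homotopic_const hi (t none) (t (some none)) e
        (fun y hy => hy none) (fun y hy => norm_pos_iff.1 (hy (some none))) fun y i hy => ?_⟩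
      by_cases h : i = i₀
      · subst h
        have hei : e i = false := dif_pos rfl
        rw [hei, signedIncl_refl, ← two_smul ℝ]
        refine smul_ne_zero two_ne_zero (norm_ne_zero_iff.1 ?_)
        rw [Sph.norm_coe]
        exact one_ne_zero
      · have hei : e i = t (some (some ⟨i, h⟩)) := dif_neg h
        rw [hei]
        exact norm_pos_iff.1 (hy (some (some ⟨i, h⟩))))
  have hr := Fin.pos i₀
  have hm₀ := hm i₀
  have hcard : Fintype.card {i : Fin r // i ≠ i₀} = r - 1 := by
    simp [Fintype.card_subtype_compl]
  rw [sum_card_block, Fintype.card_option, Fintype.card_option, hcard] at hmp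
  convert hmp using 1
  omega

end CPGPP

/-- **Theorem 5.6 (upper bound).**  For positive integers `n_1 ≤ ⋯ ≤ n_r`,
`TC(X(ℂP^n, n_1, …, n_r)) ≤ 2(n_1 + r + n) − 1`. -/
theorem tc_cpgpp_le (n r : ℕ) (hr : 0 < r) (m : Fin r → ℕ)
    (hm1 : ∀ i, 1 ≤ m i) (hmono : Monotone m) :
    TC (CPGPP n r m) ≤ (2 * (m ⟨0, hr⟩ + r + n) - 1 : ℕ) := by
  exact sInf_le
    ⟨_, rfl, CPGPP.hasMPCover (fun i => hmono (Fin.mk_le_of_le_val (Nat.zero_le _))) hm1⟩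

end Paper
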